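/- arXiv:1604.04686 — 3 statements merged into one kernel-verified Lean document; each statement's English description precedes it below -/
import Mathlib

section
/- For every ε > 0 there exists k₀ such that for all integers k ≥ k₀ the following holds: if F is a k-uniform intersecting family of finite sets with covering number τ(F) = k, then |F| ≤ (1 + ε)·k^(k-1). (Equivalently, r(k) ≤ (1+o(1))·k^(k-1), where r(k) is the maximum size of a k-uniform intersecting family with covering number k.) -/
/-- A family of finite sets is intersecting if any two members intersect. -/
def IntersectingFamily {α : Type} [DecidableEq α] (F : Finset (Finset α)) : Prop :=
  ∀ f ∈ F, ∀ g ∈ F, (f ∩ g).Nonempty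

/-- The covering number: the least size of a set meeting every member of `F`. -/
noncomputable def coverNum {α : Type} [DecidableEq α] (F : Finset (Finset α)) : ℕ :=
  sInf {n : ℕ | ∃ C : Finset α, C.card = n ∧ ∀ f ∈ F, (f ∩ C).Nonempty}

/-- The degree of a vertex: the number of members of `F` containing it. -/
def degVert {α : Type} [DecidableEq α] (F : Finset (Finset α)) (x : α) : ℕ :=
  (F.filter fun f => x ∈ f).card

/-- The degree of a set: the number of members of `F` containing it. -/
def degSet {α : Type} [DecidableEq α] (F : Finset (Finset α)) (S : Finset α) : ℕ :=
  (F.filter fun f => S ⊆ f).card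

/-- The members of `F` that contain `A` and have no further elements in `U`. -/
def traceFilter {α : Type} [DecidableEq α] (F : Finset (Finset α)) (A U : Finset α) :
    Finset (Finset α) :=
  F.filter fun f => A ⊆ f ∧ f ∩ U ⊆ A

section Counting

variable {α : Type} [DecidableEq α] {F : Finset (Finset α)} {k : ℕ}

lemma mem_traceFilter {A U f : Finset α} :
    f ∈ traceFilter F A U ↔ f ∈ F ∧ A ⊆ f ∧ f ∩ U ⊆ A := by
  simp [traceFilter]

lemma exists_disjoint_of_card_lt_coverNum {C : Finset α} (hC : C.card < coverNum F) :
    ∃ h ∈ F, Disjoint h C := by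
  by_contra! hcon
  have hle : coverNum F ≤ C.card :=
    Nat.sInf_le ⟨C, rfl, fun f hf => Finset.not_disjoint_iff_nonempty_inter.1 (hcon f hf)⟩
  omega

lemma card_traceFilter_le_one (hk : ∀ f ∈ F, f.card = k) {A : Finset α} (hA : k ≤ A.card)
    (U : Finset α) : (traceFilter F A U).card ≤ 1 := by
  refine Finset.card_le_one.2 fun f hf g hg => ?_
  rw [mem_traceFilter] at hf hg
  rw [← Finset.eq_of_subset_of_card_le hf.2.1 (by rw [hk f hf.1]; exact hA),
    Finset.eq_of_subset_of_card_le hg.2.1 (by rw [hk g hg.1]; exact hA)]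

lemma traceFilter_eq_empty (hk : ∀ f ∈ F, f.card = k) {A : Finset α} (hA : k < A.card)
    (U : Finset α) : traceFilter F A U = ∅ := by
  refine Finset.eq_empty_of_forall_notMem fun f hf => ?_
  rw [mem_traceFilter] at hf
  have := Finset.card_le_card hf.2.1
  rw [hk f hf.1] at this
  omega

/-- Branching over one common element with a member `h` disjoint from `A`. -/
lemma traceFilter_subset_biUnion_insert (hF : IntersectingFamily F) {A h : Finset α}
    (hh : h ∈ F) (hd : Disjoint h A) (U : Finset α) :
    traceFilter F A U ⊆ (h \ U).biUnion fun x => traceFilter F (insert x A) U := by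
  intro f hf
  rw [mem_traceFilter] at hf
  obtain ⟨hfF, hAf, hfU⟩ := hf
  obtain ⟨x, hx⟩ := hF f hfF h hh
  rw [Finset.mem_inter] at hx
  refine Finset.mem_biUnion.2 ⟨x, Finset.mem_sdiff.2 ⟨hx.2, fun hxU => ?_⟩, ?_⟩
  · exact Finset.disjoint_left.1 hd hx.2 (hfU (Finset.mem_inter.2 ⟨hx.1, hxU⟩))
  · exact mem_traceFilter.2 ⟨hfF, Finset.insert_subset hx.1 hAf,
      hfU.trans (Finset.subset_insert _ _)⟩

/-- Branching over the full intersection with a member `h` disjoint from `A`. -/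
lemma traceFilter_subset_biUnion_union (hF : IntersectingFamily F) {A h : Finset α}
    (hh : h ∈ F) (hd : Disjoint h A) (U : Finset α) :
    traceFilter F A U ⊆
      ((h \ U).powerset.erase ∅).biUnion fun S => traceFilter F (A ∪ S) (U ∪ h) := by
  intro f hf
  rw [mem_traceFilter] at hf
  obtain ⟨hfF, hAf, hfU⟩ := hf
  refine Finset.mem_biUnion.2 ⟨f ∩ h, ?_, ?_⟩
  · refine Finset.mem_erase.2 ⟨(hF f hfF h hh).ne_empty, Finset.mem_powerset.2 fun x hx => ?_⟩
    rw [Finset.mem_inter] at hx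
    exact Finset.mem_sdiff.2 ⟨hx.2, fun hxU =>
      Finset.disjoint_left.1 hd hx.2 (hfU (Finset.mem_inter.2 ⟨hx.1, hxU⟩))⟩
  · refine mem_traceFilter.2 ⟨hfF, Finset.union_subset hAf Finset.inter_subset_left, ?_⟩
    rw [Finset.inter_union_distrib_left]
    exact Finset.union_subset_union hfU subset_rfl

lemma card_traceFilter_le_pow (hk : ∀ f ∈ F, f.card = k) (hF : IntersectingFamily F)
    (hτ : coverNum F = k) (A U : Finset α) :
    (traceFilter F A U).card ≤ k ^ (k - A.card) := by
  induction hn : k - A.card generalizing A with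
  | zero => simpa using card_traceFilter_le_one hk (by omega) U
  | succ n ih =>
    obtain ⟨h, hh, hd⟩ := exists_disjoint_of_card_lt_coverNum (F := F) (C := A) (by omega)
    calc (traceFilter F A U).card
        ≤ ((h \ U).biUnion fun x => traceFilter F (insert x A) U).card :=
          Finset.card_le_card (traceFilter_subset_biUnion_insert hF hh hd U)
      _ ≤ (h \ U).card * k ^ n := by
          refine Finset.card_biUnion_le_card_mul _ _ _ fun x hx => ih _ ?_
          rw [Finset.card_insert_of_notMem
            (Finset.disjoint_left.1 hd (Finset.mem_sdiff.1 hx).1)]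
          omega
      _ ≤ k * k ^ n := by
          gcongr
          exact (Finset.card_le_card Finset.sdiff_subset).trans (hk h hh).le
      _ = k ^ (n + 1) := by ring

lemma sum_pow_card_erase_empty_le {s : Finset α} {x : ℝ} (hx : 0 ≤ x) (hs : s.card ≤ k)
    (h3 : (1 + x) ^ k ≤ 3) : ∑ S ∈ s.powerset.erase ∅, x ^ S.card ≤ 2 := by
  have h1 : ∑ S ∈ s.powerset, x ^ S.card = (x + 1) ^ s.card := by
    simpa using Finset.sum_pow_mul_eq_add_pow x 1 s
  have h2 := Finset.sum_erase_add s.powerset (fun S => x ^ S.card) (Finset.empty_mem_powerset s)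
  have h4 : (1 + x) ^ s.card ≤ (1 + x) ^ k := pow_le_pow_right₀ (by linarith) hs
  simp only [Finset.card_empty, pow_zero] at h2
  rw [add_comm x 1] at h1
  linarith

/-- The set `U` is the union of `j` members whose intersections with `f` have been exposed.
Every member avoiding `A ∪ B` meets `U` in at least `j` elements; a member meeting `U` in at least
`t` elements leaves only `k - t` choices for the next element, while any other one is adjoined to
`U`. -/
lemma card_traceFilter_le (hk : ∀ f ∈ F, f.card = k) (hF : IntersectingFamily F)
    (hτ : coverNum F = k) {q t : ℕ} (hq : 0 < q) (hqt : q + t = k)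
    (h3 : (1 + (q : ℝ)⁻¹) ^ k ≤ 3) (A U B : Finset α) (j : ℕ) (hjt : j ≤ t)
    (hB : B.card ≤ t * j)
    (hU : ∀ h ∈ F, Disjoint h A → Disjoint h B → j ≤ (h ∩ U).card) :
    ((traceFilter F A U).card : ℝ) ≤
      ((k : ℝ) / q) ^ (t * t) * q ^ k * 2 ^ (t - j) * (q : ℝ)⁻¹ ^ A.card := by
  have hq' : (0 : ℝ) < q := by exact_mod_cast hq
  have hkq : (1 : ℝ) ≤ (k : ℝ) / q := by
    rw [one_le_div hq']; exact_mod_cast (by omega : q ≤ k)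
  induction hn : k - A.card using Nat.strong_induction_on generalizing A U B j with
  | _ n ih =>
  set c : ℝ := ((k : ℝ) / q) ^ (t * t) * q ^ k with hc
  have hc0 : 0 < c := by positivity
  rcases lt_or_ge k A.card with hA | hA
  · rw [traceFilter_eq_empty hk hA]
    simp only [Finset.card_empty, Nat.cast_zero]
    positivity
  rcases le_or_gt k (A.card + t * t) with hAt | hAt
  · have h1 : ((traceFilter F A U).card : ℝ) ≤ (k : ℝ) ^ (k - A.card) := by
      exact_mod_cast card_traceFilter_le_pow hk hF hτ A U
    have h2 : (q : ℝ) ^ k * (q : ℝ)⁻¹ ^ A.card = (q : ℝ) ^ (k - A.card) := by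
      rw [inv_pow, pow_sub₀ _ hq'.ne' hA]
    calc ((traceFilter F A U).card : ℝ) ≤ (k : ℝ) ^ (k - A.card) := h1
      _ = ((k : ℝ) / q) ^ (k - A.card) * q ^ (k - A.card) := by
          rw [← mul_pow, div_mul_cancel₀ _ hq'.ne']
      _ ≤ ((k : ℝ) / q) ^ (t * t) * q ^ (k - A.card) := by
          gcongr ?_ * _
          exact pow_le_pow_right₀ hkq (by omega)
      _ = c * 1 * (q : ℝ)⁻¹ ^ A.card := by rw [hc, ← h2]; ring
      _ ≤ c * 2 ^ (t - j) * (q : ℝ)⁻¹ ^ A.card := by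
          gcongr
          exact one_le_pow₀ one_le_two
  have htj : t * j ≤ t * t := Nat.mul_le_mul_left t hjt
  obtain ⟨h, hh, hd⟩ := exists_disjoint_of_card_lt_coverNum (F := F) (C := A ∪ B)
    (by have := Finset.card_union_le A B; omega)
  rw [Finset.disjoint_union_right] at hd
  obtain ⟨hdA, hdB⟩ := hd
  have hhU : (h \ U).card + (h ∩ U).card = k := by
    rw [Finset.card_sdiff_add_card_inter, hk h hh]
  rcases le_or_gt t (h ∩ U).card with ht | ht
  · have hstep : ∀ x ∈ h \ U, ((traceFilter F (insert x A) U).card : ℝ) ≤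
        c * 2 ^ (t - j) * (q : ℝ)⁻¹ ^ (A.card + 1) := by
      intro x hx
      have hxA := Finset.disjoint_left.1 hdA (Finset.mem_sdiff.1 hx).1
      have hcard := Finset.card_insert_of_notMem hxA
      rw [← hcard]
      refine ih _ (by omega) (insert x A) U B j hjt hB (fun g hg hgA hgB => ?_) rfl
      exact hU g hg (hgA.mono_right (Finset.subset_insert _ _)) hgB
    calc ((traceFilter F A U).card : ℝ)
        ≤ ∑ x ∈ h \ U, ((traceFilter F (insert x A) U).card : ℝ) := by
          exact_mod_cast (Finset.card_le_card
            (traceFilter_subset_biUnion_insert hF hh hdA U)).trans Finset.card_biUnion_le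
      _ ≤ (h \ U).card • (c * 2 ^ (t - j) * (q : ℝ)⁻¹ ^ (A.card + 1)) :=
          Finset.sum_le_card_nsmul _ _ _ hstep
      _ ≤ q * (c * 2 ^ (t - j) * (q : ℝ)⁻¹ ^ (A.card + 1)) := by
          rw [nsmul_eq_mul]
          gcongr
          omega
      _ = c * 2 ^ (t - j) * (q : ℝ)⁻¹ ^ A.card := by
          rw [pow_succ]; field_simp
  · have hj : j < t := (hU h hh hdA hdB).trans_lt ht
    have hstep : ∀ S ∈ (h \ U).powerset.erase ∅,
        ((traceFilter F (A ∪ S) (U ∪ h)).card : ℝ) ≤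
          c * 2 ^ (t - (j + 1)) * (q : ℝ)⁻¹ ^ A.card * (q : ℝ)⁻¹ ^ S.card := by
      intro S hS
      rw [Finset.mem_erase, Finset.mem_powerset] at hS
      obtain ⟨hS0, hSh⟩ := hS
      have hSpos : 0 < S.card := Finset.card_pos.2 (Finset.nonempty_iff_ne_empty.2 hS0)
      have hcard : (A ∪ S).card = A.card + S.card :=
        Finset.card_union_of_disjoint
          (hdA.symm.mono_right (hSh.trans Finset.sdiff_subset))
      rw [mul_assoc _ ((q : ℝ)⁻¹ ^ A.card), ← pow_add, ← hcard]
      refine ih _ (by omega) (A ∪ S) (U ∪ h) (B ∪ (h ∩ U)) (j + 1) hj ?_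
        (fun g hg hgA hgB => ?_) rfl
      · have := Finset.card_union_le B (h ∩ U)
        rw [Nat.mul_add, Nat.mul_one]
        omega
      · rw [Finset.disjoint_union_right] at hgA hgB
        have h1 := hU g hg hgA.1 hgB.1
        obtain ⟨x, hx⟩ := hF g hg h hh
        rw [Finset.mem_inter] at hx
        have hxU : x ∉ U := fun hxU =>
          Finset.disjoint_left.1 hgB.2 hx.1 (Finset.mem_inter.2 ⟨hx.2, hxU⟩)
        have h2 : insert x (g ∩ U) ⊆ g ∩ (U ∪ h) := by
          refine Finset.insert_subset ?_
            (Finset.inter_subset_inter subset_rfl Finset.subset_union_left)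
          simp [hx.1, hx.2]
        have h3 := Finset.card_le_card h2
        rw [Finset.card_insert_of_notMem (by simp [hxU])] at h3
        omega
    calc ((traceFilter F A U).card : ℝ)
        ≤ ∑ S ∈ (h \ U).powerset.erase ∅, ((traceFilter F (A ∪ S) (U ∪ h)).card : ℝ) := by
          exact_mod_cast (Finset.card_le_card
            (traceFilter_subset_biUnion_union hF hh hdA U)).trans Finset.card_biUnion_le
      _ ≤ c * 2 ^ (t - (j + 1)) * (q : ℝ)⁻¹ ^ A.card *
            ∑ S ∈ (h \ U).powerset.erase ∅, (q : ℝ)⁻¹ ^ S.card := by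
          rw [Finset.mul_sum]
          exact Finset.sum_le_sum hstep
      _ ≤ c * 2 ^ (t - (j + 1)) * (q : ℝ)⁻¹ ^ A.card * 2 := by
          gcongr
          exact sum_pow_card_erase_empty_le (by positivity) (by omega) h3
      _ = c * 2 ^ (t - j) * (q : ℝ)⁻¹ ^ A.card := by
          rw [show t - j = t - (j + 1) + 1 by omega, pow_succ]
          ring

lemma card_le_of_coverNum_eq (hk : ∀ f ∈ F, f.card = k) (hF : IntersectingFamily F)
    (hτ : coverNum F = k) {q t : ℕ} (hq : 0 < q) (hqt : q + t = k)
    (h3 : (1 + (q : ℝ)⁻¹) ^ k ≤ 3) :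
    (F.card : ℝ) ≤ ((k : ℝ) / q) ^ (t * t) * q ^ k * 2 ^ t := by
  simpa [traceFilter] using
    card_traceFilter_le hk hF hτ hq hqt h3 ∅ ∅ ∅ 0 (Nat.zero_le _) (by simp) (by simp)

end Counting

open Filter in
lemma eventually_exists_bound_le_pow :
    ∀ᶠ k : ℕ in atTop, ∃ q t : ℕ, 0 < q ∧ q + t = k ∧ (1 + (q : ℝ)⁻¹) ^ k ≤ 3 ∧
      ((k : ℝ) / q) ^ (t * t) * q ^ k * 2 ^ t ≤ (k : ℝ) ^ (k - 1) := by
  have hlog : ∀ᶠ k : ℕ in atTop, (5 : ℝ) ≤ Real.log k :=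
    (Real.tendsto_log_atTop.comp tendsto_natCast_atTop_atTop).eventually_ge_atTop 5
  have hpow : ∀ᶠ k : ℕ in atTop, Real.log k ^ 3 ≤ (1 / 250 : ℝ) * k := by
    have h := (Real.isLittleO_pow_log_id_atTop (n := 3)).bound
      (show (0 : ℝ) < 1 / 250 by norm_num)
    filter_upwards [tendsto_natCast_atTop_atTop.eventually h] with k hk
    simp only [id, Real.norm_eq_abs, Nat.abs_cast] at hk
    exact (le_abs_self _).trans hk
  filter_upwards [hlog, hpow, eventually_ge_atTop 1] with k hL hP hk1
  set L := Real.log k with hLdef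
  have hk0 : (0 : ℝ) < k := by exact_mod_cast hk1
  obtain ⟨t, ht1, ht2⟩ : ∃ t : ℕ, 4 * L ≤ t ∧ (t : ℝ) ≤ 5 * L :=
    ⟨⌈4 * L⌉₊, Nat.le_ceil _, by
      have := Nat.ceil_lt_add_one (show 0 ≤ 4 * L by linarith)
      linarith⟩
  have ht20 : (20 : ℝ) ≤ t := by linarith
  have ht3 : (t : ℝ) ^ 3 ≤ k / 2 := by
    have : (t : ℝ) ^ 3 ≤ (5 * L) ^ 3 := by gcongr
    nlinarith
  have htk : 40 * (t : ℝ) ≤ k := by nlinarith [mul_self_nonneg ((t : ℝ) - 20)]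
  have htk' : t ≤ k := by
    have : (t : ℝ) ≤ k := by linarith
    exact_mod_cast this
  obtain ⟨q, rfl⟩ := Nat.exists_eq_add_of_le' htk'
  push_cast at *
  have hq20 : 20 * (t : ℝ) ≤ q := by linarith
  have hq0 : (0 : ℝ) < q := by linarith
  have hratio : ((q : ℝ) + t) / q = 1 + t / q := by field_simp
  have htq : (t : ℝ) / q ≤ 1 / 20 := by
    rw [div_le_div_iff₀ hq0 (by norm_num)]; linarith
  refine ⟨q, t, by exact_mod_cast hq0, rfl, ?_, ?_⟩
  · have h1 : (1 + (q : ℝ)⁻¹) ^ (q + t) ≤ Real.exp (1 + 1 / 20) := by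
      calc (1 + (q : ℝ)⁻¹) ^ (q + t) ≤ Real.exp ((q : ℝ)⁻¹) ^ (q + t) := by
            gcongr
            linarith [Real.add_one_le_exp ((q : ℝ)⁻¹)]
        _ = Real.exp (1 + t / q) := by
            rw [← Real.exp_nat_mul, ← hratio]
            push_cast
            rw [div_eq_mul_inv]
        _ ≤ Real.exp (1 + 1 / 20) := Real.exp_le_exp.2 (by linarith)
    have h2 : Real.exp (1 / 20) ≤ 20 / 19 := by
      have h := Real.one_sub_le_exp_neg (1 / 20)
      rw [Real.exp_neg, le_inv_comm₀ (by norm_num) (Real.exp_pos _)] at h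
      exact h.trans (by norm_num)
    rw [Real.exp_add] at h1
    nlinarith [Real.exp_one_lt_d9, Real.exp_pos (1 / 20)]
  · have hA : (((q : ℝ) + t) / q) ^ (t * t) ≤ Real.exp 1 := by
      calc (((q : ℝ) + t) / q) ^ (t * t) ≤ Real.exp (t / q) ^ (t * t) := by
            rw [hratio]
            gcongr
            linarith [Real.add_one_le_exp ((t : ℝ) / q)]
        _ = Real.exp (t ^ 3 / q) := by
            rw [← Real.exp_nat_mul]
            push_cast
            ring_nf
        _ ≤ Real.exp 1 := by
            rw [Real.exp_le_exp, div_le_one hq0]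
            linarith
    have hB : (q : ℝ) ^ (q + t) ≤ ((q : ℝ) + t) ^ (q + t) * Real.exp (-t) := by
      have h : (q : ℝ) ≤ (q + t) * Real.exp (-(t / (q + t))) := by
        have := Real.one_sub_le_exp_neg ((t : ℝ) / (q + t))
        calc (q : ℝ) = (q + t) * (1 - t / (q + t)) := by field_simp; ring
          _ ≤ _ := by gcongr
      calc (q : ℝ) ^ (q + t) ≤ ((q + t) * Real.exp (-(t / (q + t)))) ^ (q + t) := by gcongr
        _ = _ := by
          rw [mul_pow, ← Real.exp_nat_mul]
          push_cast
          congr 2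
          field_simp
    have hC : (2 : ℝ) ^ t = Real.exp (t * Real.log 2) := by
      rw [Real.exp_nat_mul, Real.exp_log two_pos]
    have hD : ((q : ℝ) + t) ^ (q + t) = ((q : ℝ) + t) ^ (q + t - 1) * Real.exp L := by
      rw [hLdef, Real.exp_log hk0, ← pow_succ, Nat.sub_add_cancel hk1]
    calc (((q : ℝ) + t) / q) ^ (t * t) * q ^ (q + t) * 2 ^ t
        ≤ Real.exp 1 * (((q : ℝ) + t) ^ (q + t) * Real.exp (-t)) *
            Real.exp (t * Real.log 2) := by
          rw [hC]; gcongr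
      _ = ((q : ℝ) + t) ^ (q + t - 1) * Real.exp (1 + L + -t + t * Real.log 2) := by
          rw [hD, Real.exp_add, Real.exp_add, Real.exp_add]; ring
      _ ≤ ((q : ℝ) + t) ^ (q + t - 1) * 1 := by
          gcongr
          rw [Real.exp_le_one_iff]
          nlinarith [Real.log_two_lt_d9]
      _ = _ := mul_one _

/-- `r(k) ≤ (1+o(1))·k^(k-1)`. -/
theorem upper_bound_r_k :
    ∀ ε : ℝ, 0 < ε → ∃ k₀ : ℕ, ∀ k : ℕ, k₀ ≤ k →
      ∀ (α : Type) [DecidableEq α] (F : Finset (Finset α)),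
        (∀ f ∈ F, f.card = k) → IntersectingFamily F → coverNum F = k →
        (F.card : ℝ) ≤ (1 + ε) * (k : ℝ) ^ (k - 1) := by
  intro ε hε
  obtain ⟨k₀, h₀⟩ := Filter.eventually_atTop.1 eventually_exists_bound_le_pow
  refine ⟨k₀, fun k hk α _ F hcard hF hτ => ?_⟩
  obtain ⟨q, t, hq, hqt, h3, hb⟩ := h₀ k hk
  calc (F.card : ℝ) ≤ (k : ℝ) ^ (k - 1) :=
        (card_le_of_coverNum_eq hcard hF hτ hq hqt h3).trans hb
    _ ≤ (1 + ε) * (k : ℝ) ^ (k - 1) := le_mul_of_one_le_left (by positivity) (by linarith)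
end

section
/- For every α > 0 there exists k₀ such that for all integers k ≥ k₀ the following holds: if F is a k-uniform intersecting family on a finite set X with covering number τ(F) = k, and the maximum degree satisfies Δ(F) ≤ |F| / (40·α·log k) (natural logarithm), then |F| ≤ max{2·k^(2k/3), e·k^(k-α)}. -/
lemma cast_card_filter_add_card_filter_not {ι : Type*} (s : Finset ι) (p : ι → Prop)
    [DecidablePred p] :
    ((s.filter p).card : ℝ) + ((s.filter fun i => ¬ p i).card : ℝ) = s.card := by
  exact_mod_cast s.card_filter_add_card_filter_not p

section Branching

variable {α : Type} [DecidableEq α]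

lemma sum_degSet_insert (G : Finset (Finset α)) (S A : Finset α) :
    ∑ x ∈ A, degSet G (insert x S) = ∑ f ∈ G with S ⊆ f, (f ∩ A).card := by
  simp only [degSet, Finset.card_eq_sum_ones, Finset.sum_filter, Finset.inter_comm _ A,
    ← Finset.filter_mem_eq_inter]
  rw [Finset.sum_comm]
  refine Finset.sum_congr rfl fun f _ => ?_
  by_cases h : S ⊆ f <;> simp [Finset.insert_subset_iff, h]

/-- If the members of `G` containing `S` meet the sets `A g` at least `c` times on average, then
the degree of `S` is controlled by the degree of some one-point extension inside some `A g`. -/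
lemma exists_degSet_le_insert (G 𝒢 : Finset (Finset α)) (S : Finset α)
    (A : Finset α → Finset α) {b c : ℝ} (hb : 0 < b) (hc : 0 < c) (h𝒢 : 𝒢.Nonempty)
    (hS : 0 < degSet G S) (hA : ∀ g ∈ 𝒢, ((A g).card : ℝ) ≤ b)
    (hsum : ∀ f ∈ G, S ⊆ f → c * 𝒢.card ≤ ∑ g ∈ 𝒢, ((f ∩ A g).card : ℝ)) :
    ∃ g ∈ 𝒢, ∃ x ∈ A g, (degSet G S : ℝ) ≤ b / c * degSet G (insert x S) := by
  by_contra! hcon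
  have hS' : (0 : ℝ) < degSet G S := by exact_mod_cast hS
  have h1 : c * 𝒢.card * degSet G S ≤ ∑ g ∈ 𝒢, ∑ x ∈ A g, (degSet G (insert x S) : ℝ) := by
    calc c * 𝒢.card * degSet G S = ∑ f ∈ G with S ⊆ f, c * 𝒢.card := by
          simp [degSet, mul_comm]
      _ ≤ ∑ f ∈ G with S ⊆ f, ∑ g ∈ 𝒢, ((f ∩ A g).card : ℝ) :=
          Finset.sum_le_sum fun f hf => by
            rw [Finset.mem_filter] at hf
            exact hsum f hf.1 hf.2
      _ = ∑ g ∈ 𝒢, ∑ f ∈ G with S ⊆ f, ((f ∩ A g).card : ℝ) := Finset.sum_comm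
      _ = _ := Finset.sum_congr rfl fun g _ => by exact_mod_cast (sum_degSet_insert G S (A g)).symm
  have h2 : ∑ g ∈ 𝒢, ∑ x ∈ A g, (degSet G (insert x S) : ℝ) < ∑ g ∈ 𝒢, c * degSet G S := by
    refine Finset.sum_lt_sum_of_nonempty h𝒢 fun g hg => ?_
    rcases (A g).eq_empty_or_nonempty with h0 | h0
    · rw [h0, Finset.sum_empty]
      positivity
    · calc ∑ x ∈ A g, (degSet G (insert x S) : ℝ) < ∑ x ∈ A g, c / b * degSet G S := by
            refine Finset.sum_lt_sum_of_nonempty h0 fun x hx => ?_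
            have := hcon g hg x hx
            calc (degSet G (insert x S) : ℝ)
                = c / b * (b / c * degSet G (insert x S)) := by field_simp
              _ < _ := by gcongr
        _ = (A g).card * (c / b * degSet G S) := by simp
        _ ≤ b * (c / b * degSet G S) := by
            gcongr
            exact hA g hg
        _ = c * degSet G S := by field_simp
  rw [Finset.sum_const, nsmul_eq_mul] at h2
  linarith [mul_right_comm c (𝒢.card : ℝ) (degSet G S : ℝ), mul_comm (𝒢.card : ℝ) (c * degSet G S)]

/-- Iterating a one-point extension that loses a factor `r` at every step. -/
lemma degSet_le_pow_mul (G : Finset (Finset α)) (I : Finset α → Prop) {r B : ℝ} (hr : 0 ≤ r)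
    (hB : 0 ≤ B) (N : ℕ)
    (hstep : ∀ S, I S → S.card < N → 0 < degSet G S →
      ∃ x, x ∉ S ∧ I (insert x S) ∧ (degSet G S : ℝ) ≤ r * degSet G (insert x S))
    (hend : ∀ S, I S → S.card = N → (degSet G S : ℝ) ≤ B) (S : Finset α) (hI : I S)
    (hS : S.card ≤ N) : (degSet G S : ℝ) ≤ r ^ (N - S.card) * B := by
  induction h : N - S.card generalizing S with
  | zero => simpa using hend S hI (by omega)
  | succ d ih =>
    rcases Nat.eq_zero_or_pos (degSet G S) with h0 | h0
    · rw [h0]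
      push_cast
      positivity
    · obtain ⟨x, hx, hIx, hle⟩ := hstep S hI (by omega) h0
      have hc := Finset.card_insert_of_notMem hx
      have := ih (insert x S) hIx (by omega) (by omega)
      calc (degSet G S : ℝ) ≤ r * degSet G (insert x S) := hle
        _ ≤ r * (r ^ d * B) := by gcongr
        _ = r ^ (d + 1) * B := by ring

lemma degSet_empty (G : Finset (Finset α)) : degSet G ∅ = G.card := by
  simp [degSet]

variable {F : Finset (Finset α)} {k : ℕ}

lemma degSet_le_one_of_card_eq (hk : ∀ f ∈ F, f.card = k) {G : Finset (Finset α)} (hG : G ⊆ F)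
    {S : Finset α} (hS : S.card = k) : degSet G S ≤ 1 := by
  refine Finset.card_le_one.2 fun f hf g hg => ?_
  simp only [Finset.mem_filter] at hf hg
  rw [← Finset.eq_of_subset_of_card_le hf.2 (by rw [hk f (hG hf.1), hS]),
    ← Finset.eq_of_subset_of_card_le hg.2 (by rw [hk g (hG hg.1), hS])]

/-- In an intersecting `k`-uniform family without covers of size less than `k`,
the sets of size `s` have degree at most `k ^ (k - s)`. -/
lemma degSet_le_pow (hkpos : 0 < k) (hk : ∀ f ∈ F, f.card = k) (hF : IntersectingFamily F)
    (hτ : ∀ S : Finset α, S.card < k → ∃ f ∈ F, Disjoint f S) {G : Finset (Finset α)}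
    (hG : G ⊆ F) (S : Finset α) (hS : S.card ≤ k) :
    (degSet G S : ℝ) ≤ (k : ℝ) ^ (k - S.card) := by
  have := degSet_le_pow_mul G (fun _ => True) (r := k) (B := 1) (by positivity) one_pos.le k
    (fun S _ hS h0 => ?_)
    (fun S _ hS => by exact_mod_cast degSet_le_one_of_card_eq hk hG hS) S trivial hS
  · simpa using this
  obtain ⟨g, hg, hgS⟩ := hτ S hS
  obtain ⟨g', hg', x, hx, hle⟩ := exists_degSet_le_insert G {g} S id (b := k) (c := 1)
    (by exact_mod_cast hkpos) one_pos (Finset.singleton_nonempty g) h0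
    (by simp [hk g hg]) (fun f hf _ => by
      simpa using (hF f (hG hf) g hg))
  rw [Finset.mem_singleton] at hg'
  subst hg'
  exact ⟨x, Finset.disjoint_left.1 hgS hx, trivial, by simpa using hle⟩

/-- Iterating `m` times a step that loses only a factor `q * k` bounds the size of `G`. -/
lemma card_le_of_step (hkpos : 0 < k) (hk : ∀ f ∈ F, f.card = k) (hF : IntersectingFamily F)
    (hτ : ∀ S : Finset α, S.card < k → ∃ f ∈ F, Disjoint f S) {G : Finset (Finset α)}
    (hG : G ⊆ F) {q : ℝ} (hq : 0 ≤ q) {m : ℕ} (hm : m ≤ k)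
    (hstep : ∀ S : Finset α, S.card < m → 0 < degSet G S →
      ∃ x, x ∉ S ∧ (degSet G S : ℝ) ≤ q * k * degSet G (insert x S)) :
    (G.card : ℝ) ≤ q ^ m * (k : ℝ) ^ k := by
  have := degSet_le_pow_mul G (fun _ => True) (r := q * k) (B := (k : ℝ) ^ (k - m))
    (by positivity) (by positivity) m
    (fun S _ hS h0 => by
      obtain ⟨x, hx, hle⟩ := hstep S hS h0
      exact ⟨x, hx, trivial, hle⟩)
    (fun S _ hS => hS ▸ degSet_le_pow hkpos hk hF hτ hG S (by omega)) ∅ trivial (by simp)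
  rw [degSet_empty, Finset.card_empty, Nat.sub_zero, mul_pow, mul_assoc, ← pow_add,
    Nat.add_sub_cancel' hm] at this
  exact this

lemma card_not_disjoint_le {η : ℝ} (hη : ∀ x, (degVert F x : ℝ) ≤ η) {G : Finset (Finset α)}
    (hG : G ⊆ F) (S : Finset α) :
    ((G.filter fun g => ¬ Disjoint g S).card : ℝ) ≤ S.card * η := by
  have h1 : (G.filter fun g => ¬ Disjoint g S) ⊆ S.biUnion fun x => F.filter fun f => x ∈ f := by
    intro g hg
    rw [Finset.mem_filter, Finset.not_disjoint_iff] at hg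
    obtain ⟨hgG, x, hxg, hxS⟩ := hg
    exact Finset.mem_biUnion.2 ⟨x, hxS, Finset.mem_filter.2 ⟨hG hgG, hxg⟩⟩
  calc ((G.filter fun g => ¬ Disjoint g S).card : ℝ)
      ≤ ∑ x ∈ S, (degVert F x : ℝ) := by
        exact_mod_cast (Finset.card_le_card h1).trans Finset.card_biUnion_le
    _ ≤ ∑ x ∈ S, η := Finset.sum_le_sum fun x _ => hη x
    _ = S.card * η := by simp

end Branching

section Cases

variable {α : Type} [DecidableEq α] {F : Finset (Finset α)} {k j : ℕ} {η : ℝ}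

/-- If many members of `F` contain a small set meeting almost all of `F`, then `F` is small. -/
lemma card_le_of_concentrated (hkpos : 0 < k) (hk : ∀ f ∈ F, f.card = k)
    (hF : IntersectingFamily F) (hτ : ∀ S : Finset α, S.card < k → ∃ f ∈ F, Disjoint f S)
    (hn : 0 < F.card) (hη : ∀ x, (degVert F x : ℝ) ≤ η) (hηj : η * (40 * j) ≤ F.card)
    (hj : 12 * j ≤ k) (𝒦 : Finset (Finset α)) (h𝒦 : 𝒦 ⊆ F) (h𝒦n : (F.card : ℝ) ≤ 2 * 𝒦.card)
    (A : Finset α → Finset α) (hA : ∀ g ∈ 𝒦, A g ⊆ g) (hAk : ∀ g ∈ 𝒦, 8 * (A g).card ≤ 7 * k)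
    (hAF : ∀ g ∈ 𝒦, 1000 * (((F.filter fun f => Disjoint f (A g)).card : ℕ) : ℝ) ≤ F.card) :
    (F.card : ℝ) ≤ 2 * ((1 / 3) ^ j * (k : ℝ) ^ k) := by
  have hn' : (0 : ℝ) < F.card := by exact_mod_cast hn
  set n : ℝ := (F.card : ℝ) with hndef
  let bad : Finset α → ℝ := fun f => ((𝒦.filter fun g => Disjoint f (A g)).card : ℝ)
  let G := F.filter fun f => 1000 * bad f ≤ 4 * n
  have hGF : G ⊆ F := Finset.filter_subset _ _
  have hbad : 1000 * ∑ f ∈ F, bad f ≤ n * n := by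
    have h1 : ∑ f ∈ F, bad f = ∑ g ∈ 𝒦, ((F.filter fun f => Disjoint f (A g)).card : ℝ) := by
      simp only [bad, Finset.card_eq_sum_ones, Finset.sum_filter]
      push_cast
      exact Finset.sum_comm
    rw [h1, Finset.mul_sum]
    calc _ ≤ ∑ g ∈ 𝒦, n := Finset.sum_le_sum hAF
      _ = 𝒦.card * n := by simp
      _ ≤ n * n := by
        gcongr
        exact Nat.cast_le.2 (Finset.card_le_card h𝒦)
  have hG : n ≤ 2 * G.card := by
    have h1 : ∑ f ∈ F.filter (fun f => ¬ 1000 * bad f ≤ 4 * n), 4 * n ≤ 1000 * ∑ f ∈ F, bad f := by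
      rw [Finset.mul_sum]
      refine (Finset.sum_le_sum fun f hf => ?_).trans
        (Finset.sum_le_sum_of_subset_of_nonneg (Finset.filter_subset _ _) fun f _ _ => ?_)
      · exact (not_le.1 (Finset.mem_filter.1 hf).2).le
      · positivity
    have h2 : (G.card : ℝ) + ((F.filter (fun f => ¬ 1000 * bad f ≤ 4 * n)).card : ℝ) = n :=
      cast_card_filter_add_card_filter_not _ _
    rw [Finset.sum_const, nsmul_eq_mul] at h1
    have h3 : ((F.filter (fun f => ¬ 1000 * bad f ≤ 4 * n)).card : ℝ) * 4 ≤ n := by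
      refine le_of_mul_le_mul_right ?_ hn'
      linarith
    linarith
  have hη0 : 0 ≤ η := by
    obtain ⟨f, hf⟩ := Finset.card_pos.1 hn
    obtain ⟨x, hx⟩ : f.Nonempty := Finset.card_pos.1 (by rw [hk f hf]; exact hkpos)
    exact (Nat.cast_nonneg _).trans (hη x)
  have key := card_le_of_step hkpos hk hF hτ hGF (q := 7 / 8 / (98 / 100)) (by norm_num) hj
    fun S hS h0 => by
    have hSη : (S.card : ℝ) * η ≤ 3 / 10 * n := by
      have : (S.card : ℝ) ≤ 12 * j := by exact_mod_cast hS.le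
      nlinarith
    let 𝒢 := 𝒦.filter fun g => Disjoint g S
    have h𝒢 : n / 5 ≤ 𝒢.card := by
      have h1 := card_not_disjoint_le hη h𝒦 S
      have h2 : (𝒢.card : ℝ) + ((𝒦.filter fun g => ¬ Disjoint g S).card : ℝ) = 𝒦.card :=
      cast_card_filter_add_card_filter_not _ _
      linarith
    obtain ⟨g, hg, x, hx, hle⟩ := exists_degSet_le_insert G 𝒢 S A (b := 7 / 8 * k)
      (c := 98 / 100) (by positivity) (by norm_num)
      (Finset.card_pos.1 (by exact_mod_cast (by positivity : 0 < n / 5).trans_le h𝒢)) h0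
      (fun g hg => by
        have : (8 : ℝ) * (A g).card ≤ 7 * k := by
          exact_mod_cast hAk g (Finset.mem_filter.1 hg).1
        linarith)
      (fun f hf _ => by
        have h1 : 1000 * bad f ≤ 4 * n := (Finset.mem_filter.1 hf).2
        have h2 : ((𝒢.filter fun g => Disjoint f (A g)).card : ℝ) ≤ bad f :=
          Nat.cast_le.2 (Finset.card_le_card
            (Finset.filter_subset_filter _ (Finset.filter_subset _ _)))
        have h3 : ((𝒢.filter fun g => Disjoint f (A g)).card : ℝ)
            + ((𝒢.filter fun g => ¬ Disjoint f (A g)).card : ℝ) = 𝒢.card :=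
      cast_card_filter_add_card_filter_not _ _
        have h4 : ((𝒢.filter fun g => ¬ Disjoint f (A g)).card : ℝ)
            ≤ ∑ g ∈ 𝒢, ((f ∩ A g).card : ℝ) := by
          rw [Finset.card_filter]
          push_cast
          refine Finset.sum_le_sum fun g _ => ?_
          split_ifs with h
          · positivity
          · exact_mod_cast Finset.card_pos.2 (Finset.not_disjoint_iff_nonempty_inter.1 h)
        linarith)
    rw [Finset.mem_filter] at hg
    refine ⟨x, Finset.disjoint_left.1 hg.2 (hA g hg.1 hx), ?_⟩
    calc _ ≤ _ := hle
      _ = _ := by ring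
  have hpow : ((7 : ℝ) / 8 / (98 / 100)) ^ (12 * j) ≤ (1 / 3) ^ j := by
    rw [pow_mul]
    gcongr
    norm_num
  calc n ≤ 2 * G.card := hG
    _ ≤ 2 * (((7 : ℝ) / 8 / (98 / 100)) ^ (12 * j) * (k : ℝ) ^ k) := by gcongr
    _ ≤ _ := by gcongr

/-- There are few sets meeting a third of `F` in at least two elements each. -/
lemma card_le_of_double_intersections (hkpos : 0 < k) (hk : ∀ f ∈ F, f.card = k)
    (hF : IntersectingFamily F) (hτ : ∀ S : Finset α, S.card < k → ∃ f ∈ F, Disjoint f S)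
    (hn : 0 < F.card) (hη : ∀ x, (degVert F x : ℝ) ≤ η) (hηj : η * (40 * j) ≤ F.card)
    (hj : 12 * j ≤ k) {G : Finset (Finset α)} (hG : G ⊆ F)
    (hG2 : ∀ f ∈ G, (F.card : ℝ) ≤ 3 * ((F.filter fun g => (f ∩ g).card ≠ 1).card : ℕ)) :
    (G.card : ℝ) ≤ (1 / 3) ^ j * (k : ℝ) ^ k := by
  have hn' : (0 : ℝ) < F.card := by exact_mod_cast hn
  set n : ℝ := (F.card : ℝ) with hndef
  have hη0 : 0 ≤ η := by
    obtain ⟨f, hf⟩ := Finset.card_pos.1 hn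
    obtain ⟨x, hx⟩ : f.Nonempty := Finset.card_pos.1 (by rw [hk f hf]; exact hkpos)
    exact (Nat.cast_nonneg _).trans (hη x)
  have key := card_le_of_step hkpos hk hF hτ hG (q := 1 / (119 / 100)) (m := 7 * j) (by norm_num)
    (by omega) fun S hS h0 => by
    have hSη : (S.card : ℝ) * η ≤ 7 / 40 * n := by
      have : (S.card : ℝ) ≤ 7 * j := by exact_mod_cast hS.le
      nlinarith
    let 𝒢 := F.filter fun g => Disjoint g S
    have hpart : (𝒢.card : ℝ) + ((F.filter fun g => ¬ Disjoint g S).card : ℝ) = n :=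
      cast_card_filter_add_card_filter_not _ _
    have hmeet := card_not_disjoint_le hη Finset.Subset.rfl S
    obtain ⟨g, hg, x, hx, hle⟩ := exists_degSet_le_insert G 𝒢 S id (b := k)
      (c := 119 / 100) (by positivity) (by norm_num)
      (Finset.card_pos.1 (by
        have : (0 : ℝ) < 𝒢.card := by linarith
        exact_mod_cast this)) h0
      (fun g hg => by simp [hk g (Finset.mem_filter.1 hg).1])
      (fun f hf _ => by
        have h1 := hG2 f hf
        have h2 : ((F.filter fun g => (f ∩ g).card ≠ 1).card : ℝ)
            ≤ ((𝒢.filter fun g => (f ∩ g).card ≠ 1).card : ℝ)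
              + ((F.filter fun g => ¬ Disjoint g S).card : ℝ) := by
          norm_cast
          refine (Finset.card_le_card fun g hg => ?_).trans (Finset.card_union_le _ _)
          simp only [𝒢, Finset.mem_union, Finset.mem_filter] at hg ⊢
          tauto
        have h3 : (𝒢.card : ℝ) + ((𝒢.filter fun g => (f ∩ g).card ≠ 1).card : ℝ)
            ≤ ∑ g ∈ 𝒢, ((f ∩ g).card : ℝ) := by
          rw [Finset.card_eq_sum_ones 𝒢, Finset.card_filter _ 𝒢]
          push_cast
          rw [← Finset.sum_add_distrib]
          refine Finset.sum_le_sum fun g hg => ?_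
          have := Finset.card_pos.2 (hF f (hG hf) g (Finset.mem_filter.1 hg).1)
          split_ifs with h
          · exact_mod_cast (by omega : 1 + 1 ≤ (f ∩ g).card)
          · exact_mod_cast this
        simp only [id]
        linarith)
    rw [Finset.mem_filter] at hg
    refine ⟨x, Finset.disjoint_left.1 hg.2 hx, ?_⟩
    calc _ ≤ _ := hle
      _ = _ := by ring
  have hpow : ((1 : ℝ) / (119 / 100)) ^ (7 * j) ≤ (1 / 3) ^ j := by
    rw [pow_mul]
    gcongr
    norm_num
  calc _ ≤ _ := key
    _ ≤ _ := by gcongr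

/-- The members of `F` meeting `Y` in fewer than `T` elements, each weighted by a factor `1 / 2`
for every common element. -/
noncomputable def thinWeight (F : Finset (Finset α)) (T : ℕ) (Y : Finset α) : ℝ :=
  ∑ g ∈ F with (g ∩ Y).card < T, (1 / 2 : ℝ) ^ (g ∩ Y).card

lemma thinWeight_empty_le (T : ℕ) : thinWeight F T ∅ ≤ F.card := by
  simp only [thinWeight, Finset.inter_empty, Finset.card_empty, pow_zero, Finset.sum_const,
    nsmul_eq_mul, mul_one]
  exact_mod_cast Finset.card_filter_le _ _

lemma card_thin_le (T : ℕ) (Y : Finset α) :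
    ((F.filter fun g => (g ∩ Y).card < T).card : ℝ) ≤ 2 ^ T * thinWeight F T Y := by
  rw [thinWeight, Finset.mul_sum, Finset.card_eq_sum_ones]
  push_cast
  refine Finset.sum_le_sum fun g hg => ?_
  rw [one_div, inv_pow, ← div_eq_mul_inv, one_le_div (by positivity)]
  exact pow_le_pow_right₀ (by norm_num) (Finset.mem_filter.1 hg).2.le

/-- Enlarging `Y` by an average member of `E` shrinks the weight by a constant factor. -/
lemma sum_thinWeight_union_le (hF : IntersectingFamily F) (hη : ∀ x, (degVert F x : ℝ) ≤ η)
    (hη0 : 0 ≤ η) {E : Finset (Finset α)} (hE : E ⊆ F) {T : ℕ}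
    (hT : T * η ≤ 7 / 40 * F.card) (hEn : (2 : ℝ) * F.card ≤ 3 * E.card) (Y : Finset α) :
    ∑ e ∈ E, thinWeight F T (Y ∪ e) ≤ E.card * (16 / 25 * thinWeight F T Y) := by
  simp only [thinWeight, Finset.sum_filter]
  rw [Finset.sum_comm, Finset.mul_sum, Finset.mul_sum]
  refine Finset.sum_le_sum fun g hg => ?_
  have hmono : ∀ e, (g ∩ Y).card ≤ (g ∩ (Y ∪ e)).card := fun e =>
    Finset.card_le_card (Finset.inter_subset_inter_left Finset.subset_union_left)
  split_ifs with hlt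
  · have hmeet := card_not_disjoint_le hη hE (g ∩ Y)
    have hpart : ((E.filter fun e => Disjoint e (g ∩ Y)).card : ℝ)
        + ((E.filter fun e => ¬ Disjoint e (g ∩ Y)).card : ℝ) = E.card :=
      cast_card_filter_add_card_filter_not _ _
    have hle : ((g ∩ Y).card : ℝ) * η ≤ T * η := by gcongr
    calc ∑ e ∈ E, (if (g ∩ (Y ∪ e)).card < T then (1 / 2 : ℝ) ^ (g ∩ (Y ∪ e)).card else 0)
        ≤ ∑ e ∈ E, (1 / 2 : ℝ) ^ (g ∩ Y).card
            * (1 / 2 + 1 / 2 * if ¬ Disjoint e (g ∩ Y) then 1 else 0) := by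
          refine Finset.sum_le_sum fun e he => ?_
          have hle1 : (if (g ∩ (Y ∪ e)).card < T then (1 / 2 : ℝ) ^ (g ∩ (Y ∪ e)).card else 0)
              ≤ (1 / 2 : ℝ) ^ (g ∩ (Y ∪ e)).card := by
            split_ifs
            · exact le_rfl
            · positivity
          refine hle1.trans ?_
          split_ifs with hd
          · have : (g ∩ Y).card + 1 ≤ (g ∩ (Y ∪ e)).card := by
              rw [Finset.inter_union_distrib_left, Finset.card_union_of_disjoint]
              · exact Nat.add_le_add_left (Finset.card_pos.2 (hF g hg e (hE he))) _
              · exact hd.symm.mono_right Finset.inter_subset_right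
            calc (1 / 2 : ℝ) ^ (g ∩ (Y ∪ e)).card ≤ (1 / 2 : ℝ) ^ ((g ∩ Y).card + 1) :=
                  pow_le_pow_of_le_one (by norm_num) (by norm_num) this
              _ = _ := by ring
          · calc (1 / 2 : ℝ) ^ (g ∩ (Y ∪ e)).card ≤ (1 / 2 : ℝ) ^ (g ∩ Y).card :=
                  pow_le_pow_of_le_one (by norm_num) (by norm_num) (hmono e)
              _ = _ := by ring
      _ = (1 / 2 : ℝ) ^ (g ∩ Y).card
            * (E.card / 2 + ((E.filter fun e => ¬ Disjoint e (g ∩ Y)).card : ℝ) / 2) := by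
          rw [← Finset.mul_sum, Finset.sum_add_distrib, ← Finset.mul_sum, Finset.sum_boole]
          simp only [Finset.sum_const, nsmul_eq_mul]
          ring
      _ ≤ (1 / 2 : ℝ) ^ (g ∩ Y).card * (16 / 25 * E.card) := by
          gcongr
          linarith
      _ = _ := by ring
  · rw [mul_zero, mul_zero]
    exact (Finset.sum_eq_zero fun e _ => if_neg fun h => hlt ((hmono e).trans_lt h)).le

/-- One step of the selection of members of `F` meeting the sets of `H` in single elements:
`Y` is the union of the members selected so far and `Z` the common trace of `H` on `Y`. -/
lemma exists_trace_step (hkpos : 0 < k) (hk : ∀ f ∈ F, f.card = k) (hF : IntersectingFamily F)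
    (hn : 0 < F.card) (hη : ∀ x, (degVert F x : ℝ) ≤ η) (hη0 : 0 ≤ η) {T : ℕ}
    (hT : T * η ≤ 7 / 40 * F.card) {H : Finset (Finset α)}
    (hH : ∀ f ∈ H, (2 : ℝ) * F.card ≤ 3 * ((F.filter fun g => (f ∩ g).card = 1).card : ℕ))
    {Y Z : Finset α} (hYZ : ∀ f ∈ H, f ∩ Y = Z) {K : ℝ} (hK : 0 ≤ K)
    (hpos : 0 < H.card * (1 - K * (16 / 25) * thinWeight F T Y)) :
    ∃ Y' Z' : Finset α, ∃ H' ⊆ H, (∀ f ∈ H', f ∩ Y' = Z') ∧ Z'.card ≤ Z.card + 1 ∧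
      2 / 3 * (H.card * (k : ℝ) ^ Z.card * (1 - K * (16 / 25) * thinWeight F T Y)) ≤
        H'.card * (k : ℝ) ^ Z'.card * (1 - K * thinWeight F T Y') := by
  set v := 1 - K * (16 / 25) * thinWeight F T Y with hv
  have hv0 : 0 < v := pos_of_mul_pos_right hpos (Nat.cast_nonneg _)
  let E : Finset α → Finset (Finset α) := fun f => F.filter fun g => (f ∩ g).card = 1
  let R : Finset α → Finset (Finset α) := fun e => H.filter fun f => (f ∩ e).card = 1
  obtain ⟨e, he, hle⟩ : ∃ e ∈ F, 2 / 3 * (H.card * v) ≤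
      (R e).card * (1 - K * thinWeight F T (Y ∪ e)) := by
    refine Finset.exists_le_of_sum_le (Finset.card_pos.1 hn) ?_
    calc ∑ e ∈ F, 2 / 3 * (H.card * v) = ∑ f ∈ H, 2 / 3 * F.card * v := by
          simp only [Finset.sum_const, nsmul_eq_mul]
          ring
      _ ≤ ∑ f ∈ H, ∑ e ∈ E f, (1 - K * thinWeight F T (Y ∪ e)) := by
          refine Finset.sum_le_sum fun f hf => ?_
          have h1 : (2 : ℝ) * F.card ≤ 3 * (E f).card := hH f hf
          have h2 := sum_thinWeight_union_le hF hη hη0 (Finset.filter_subset _ _ : E f ⊆ F) hT h1 Y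
          calc 2 / 3 * F.card * v ≤ (E f).card * v := by
                gcongr
                linarith
            _ = (E f).card - K * ((E f).card * (16 / 25 * thinWeight F T Y)) := by
                rw [hv]
                ring
            _ ≤ (E f).card - K * ∑ e ∈ E f, thinWeight F T (Y ∪ e) := by gcongr
            _ = _ := by
                rw [Finset.sum_sub_distrib, ← Finset.mul_sum]
                simp
      _ = ∑ e ∈ F, (R e).card * (1 - K * thinWeight F T (Y ∪ e)) := by
          simp only [E, R, Finset.sum_filter]
          rw [Finset.sum_comm]
          refine Finset.sum_congr rfl fun e _ => ?_
          rw [← Finset.sum_filter, Finset.sum_const, nsmul_eq_mul]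
  have hRpos : 0 < (R e).card * (1 - K * thinWeight F T (Y ∪ e)) :=
    lt_of_lt_of_le (by positivity) hle
  have hw : 0 < 1 - K * thinWeight F T (Y ∪ e) := pos_of_mul_pos_right hRpos (Nat.cast_nonneg _)
  have hR : 0 < (R e).card := by
    exact_mod_cast pos_of_mul_pos_left hRpos hw.le
  have hRH : R e ⊆ H := Finset.filter_subset _ _
  by_cases hZ : Disjoint Z e
  · obtain ⟨e', he', x, hx, hxle⟩ := exists_degSet_le_insert (R e) {e} ∅ id (b := k) (c := 1)
      (by exact_mod_cast hkpos) one_pos (Finset.singleton_nonempty e) (by rwa [degSet_empty])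
      (by simp [hk e he]) (fun f hf _ => by simp [(Finset.mem_filter.1 hf).2])
    rw [Finset.mem_singleton] at he'
    subst he'
    have hxZ : x ∉ Z := Finset.disjoint_right.1 hZ hx
    refine ⟨Y ∪ e', insert x Z, (R e').filter fun f => insert x ∅ ⊆ f,
      (Finset.filter_subset _ _).trans hRH, fun f hf => ?_,
      (Finset.card_insert_of_notMem hxZ).le, ?_⟩
    · obtain ⟨hfR, hxf⟩ := Finset.mem_filter.1 hf
      obtain ⟨hfH, hf1⟩ := Finset.mem_filter.1 hfR
      have hxf' : x ∈ f ∩ e' := Finset.mem_inter.2 ⟨hxf (Finset.mem_insert_self _ _), hx⟩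
      obtain ⟨y, hy⟩ := Finset.card_eq_one.1 hf1
      rw [hy, Finset.mem_singleton] at hxf'
      rw [Finset.inter_union_distrib_left, hYZ f hfH, hy, hxf', Finset.union_comm]
      rfl
    · rw [degSet_empty, div_one] at hxle
      rw [Finset.card_insert_of_notMem hxZ]
      calc 2 / 3 * (H.card * (k : ℝ) ^ Z.card * v) = (k : ℝ) ^ Z.card * (2 / 3 * (H.card * v)) := by
            ring
        _ ≤ (k : ℝ) ^ Z.card * ((R e').card * (1 - K * thinWeight F T (Y ∪ e'))) := by gcongr
        _ ≤ (k : ℝ) ^ Z.card * ((k * degSet (R e') (insert x ∅))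
              * (1 - K * thinWeight F T (Y ∪ e'))) := by gcongr
        _ = _ := by
            rw [degSet]
            ring
  · refine ⟨Y ∪ e, Z, R e, hRH, fun f hf => ?_, Nat.le_succ _, ?_⟩
    · obtain ⟨hfH, hf1⟩ := Finset.mem_filter.1 hf
      obtain ⟨z, hzZ, hze⟩ := Finset.not_disjoint_iff.1 hZ
      have hzf : z ∈ f ∩ e :=
        Finset.mem_inter.2 ⟨(Finset.mem_inter.1 (hYZ f hfH ▸ hzZ)).1, hze⟩
      obtain ⟨y, hy⟩ := Finset.card_eq_one.1 hf1
      rw [hy, Finset.mem_singleton] at hzf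
      subst hzf
      rw [Finset.inter_union_distrib_left, hYZ f hfH, hy]
      exact Finset.union_eq_left.2 (Finset.singleton_subset_iff.2 hzZ)
    · calc 2 / 3 * (H.card * (k : ℝ) ^ Z.card * v) = (k : ℝ) ^ Z.card * (2 / 3 * (H.card * v)) := by
            ring
        _ ≤ (k : ℝ) ^ Z.card * ((R e).card * (1 - K * thinWeight F T (Y ∪ e))) := by gcongr
        _ = _ := by ring

lemma exists_trace (hkpos : 0 < k) (hk : ∀ f ∈ F, f.card = k) (hF : IntersectingFamily F)
    (hn : 0 < F.card) (hη : ∀ x, (degVert F x : ℝ) ≤ η) (hη0 : 0 ≤ η) {T : ℕ}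
    (hT : T * η ≤ 7 / 40 * F.card) {H : Finset (Finset α)} (hH0 : 0 < H.card)
    (hH : ∀ f ∈ H, (2 : ℝ) * F.card ≤ 3 * ((F.filter fun g => (f ∩ g).card = 1).card : ℕ))
    (i : ℕ) {K : ℝ} (hK : 0 ≤ K) (hKn : K * (16 / 25) ^ i * F.card ≤ 1 / 2) :
    ∃ Y Z : Finset α, ∃ H' ⊆ H, (∀ f ∈ H', f ∩ Y = Z) ∧ Z.card ≤ i ∧
      (2 / 3) ^ i * (H.card * (1 / 2) : ℝ) ≤
        H'.card * (k : ℝ) ^ Z.card * (1 - K * thinWeight F T Y) := by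
  induction i generalizing K with
  | zero =>
    refine ⟨∅, ∅, H, Finset.Subset.rfl, by simp, by simp, ?_⟩
    have h1 : K * thinWeight F T ∅ ≤ K * F.card := by
      gcongr
      exact thinWeight_empty_le T
    simp only [pow_zero, one_mul, mul_one, Finset.card_empty] at hKn ⊢
    gcongr
    linarith
  | succ i ih =>
    obtain ⟨Y, Z, H', hH', hYZ, hZ, hle⟩ := ih (K := K * (16 / 25)) (by positivity)
      (by rw [pow_succ'] at hKn; linarith)
    have hk0 : (0 : ℝ) < (k : ℝ) ^ Z.card := by positivity
    have hpos : 0 < H'.card * (1 - K * (16 / 25) * thinWeight F T Y) := by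
      refine pos_of_mul_pos_right (a := (k : ℝ) ^ Z.card) ?_ hk0.le
      calc (0 : ℝ) < (2 / 3) ^ i * (H.card * (1 / 2) : ℝ) := by positivity
        _ ≤ _ := hle
        _ = _ := by ring
    obtain ⟨Y', Z', H'', hH'', hYZ', hZ', hle'⟩ := exists_trace_step hkpos hk hF hn hη hη0 hT
      (fun f hf => hH f (hH' hf)) hYZ hK hpos
    refine ⟨Y', Z', H'', hH''.trans hH', hYZ', by omega, le_trans ?_ hle'⟩
    rw [pow_succ']
    linarith

lemma sub_pow_le_exp_mul_pow {k T : ℝ} (hk : 0 < k) (hT : T ≤ k) (N : ℕ) :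
    (k - T) ^ N ≤ Real.exp (-(T * N / k)) * k ^ N := by
  have h1 : k - T ≤ Real.exp (-(T / k)) * k := by
    have := Real.add_one_le_exp (-(T / k))
    calc k - T = (-(T / k) + 1) * k := by field_simp; ring
      _ ≤ _ := by gcongr
  calc (k - T) ^ N ≤ (Real.exp (-(T / k)) * k) ^ N := by
        gcongr
    _ = _ := by
        rw [mul_pow, ← Real.exp_nat_mul]
        ring_nf

/-- There are few sets without a small subset meeting almost all of `F` which meet two thirds
of `F` in a single element each. -/
lemma card_le_of_single_intersections (hk : ∀ f ∈ F, f.card = k)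
    (hF : IntersectingFamily F) (hτ : ∀ S : Finset α, S.card < k → ∃ f ∈ F, Disjoint f S)
    (hn : 0 < F.card) (hη : ∀ x, (degVert F x : ℝ) ≤ η) (hη0 : 0 ≤ η)
    (hηj : η * (40 * j) ≤ F.card) (hj : 20 ≤ j) (hjk : 672 * j ≤ k) {L : ℕ} (hL : 7 * k ≤ 8 * L)
    (hLk : L ≤ k) {H : Finset (Finset α)} (hHF : H ⊆ F)
    (hH : ∀ f ∈ H, (2 : ℝ) * F.card ≤ 3 * ((F.filter fun g => (f ∩ g).card = 1).card : ℕ))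
    (hHL : ∀ f ∈ H, ∀ C ⊆ f, C.card < L →
      (F.card : ℝ) ≤ 1000 * ((F.filter fun g => Disjoint g C).card : ℕ)) :
    (H.card : ℝ) ≤ 2 * ((1 / 3) ^ j * (k : ℝ) ^ k) := by
  have hkpos : 0 < k := by omega
  have hk0 : (0 : ℝ) < k := by exact_mod_cast hkpos
  have hn' : (0 : ℝ) < F.card := by exact_mod_cast hn
  have hjk' : (672 : ℝ) * j ≤ k := by exact_mod_cast hjk
  rcases Nat.eq_zero_or_pos H.card with hH0 | hH0
  · rw [hH0]
    push_cast
    positivity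
  obtain ⟨Y, Z, H', hH', hYZ, hZ, hle⟩ := exists_trace hkpos hk hF hn hη hη0 (T := 7 * j)
    (by push_cast; linarith) hH0 hH (12 * j) (K := 2 ^ (7 * j) * 1000 / F.card) (by positivity) (by
      calc (2 : ℝ) ^ (7 * j) * 1000 / F.card * (16 / 25) ^ (12 * j) * F.card
          = 1000 * (2 ^ 7 * (16 / 25) ^ 12) ^ j := by
            rw [pow_mul, pow_mul, mul_pow]
            field_simp
        _ ≤ 1000 * (61 / 100) ^ j := by
            gcongr
            norm_num
        _ ≤ 1000 * (61 / 100) ^ 20 := by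
            exact mul_le_mul_of_nonneg_left
              (pow_le_pow_of_le_one (by norm_num) (by norm_num) hj) (by norm_num)
        _ ≤ 1 / 2 := by norm_num)
  have hW0 : 0 ≤ thinWeight F (7 * j) Y := Finset.sum_nonneg fun _ _ => by positivity
  have hw : 0 < 1 - 2 ^ (7 * j) * 1000 / F.card * thinWeight F (7 * j) Y := by
    refine pos_of_mul_pos_right (lt_of_lt_of_le ?_ hle) (by positivity)
    positivity
  have hthin : 1000 * ((F.filter fun g => (g ∩ Y).card < 7 * j).card : ℝ) < F.card := by
    have h1 := card_thin_le (F := F) (7 * j) Y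
    have h2 : 2 ^ (7 * j) * 1000 / F.card * thinWeight F (7 * j) Y * F.card < 1 * F.card := by
      gcongr
      linarith
    rw [div_mul_eq_mul_div, div_mul_cancel₀ _ hn'.ne'] at h2
    linarith
  have hmain := degSet_le_pow_mul H' (fun S => Z ⊆ S) (r := k - 7 * j)
    (B := (k : ℝ) ^ (k - L)) (by linarith) (by positivity) L (fun S hZS hS h0 => by
      obtain ⟨f, hf⟩ := Finset.card_pos.1 h0
      rw [Finset.mem_filter] at hf
      have hfat := hHL f (hH' hf.1) S hf.2 hS
      obtain ⟨g, hgS, hgY⟩ : ∃ g ∈ F.filter (fun g => Disjoint g S),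
          g ∉ F.filter fun g => (g ∩ Y).card < 7 * j := by
        refine Finset.exists_mem_notMem_of_card_lt_card ?_
        have := hthin.trans_le hfat
        exact_mod_cast lt_of_mul_lt_mul_left this (by norm_num)
      rw [Finset.mem_filter] at hgS
      have hgT : 7 * j ≤ (g ∩ Y).card := by
        by_contra hlt
        exact hgY (Finset.mem_filter.2 ⟨hgS.1, not_le.1 hlt⟩)
      obtain ⟨g', hg', x, hx, hxle⟩ := exists_degSet_le_insert H' {g} S (fun g => g \ Y)
        (b := k - 7 * j) (c := 1) (by linarith) one_pos (Finset.singleton_nonempty g) h0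
        (fun g' hg' => by
          rw [Finset.mem_singleton.1 hg']
          have h1 := Finset.card_sdiff_add_card_inter g Y
          rw [hk g hgS.1] at h1
          have h2 : ((g \ Y).card : ℝ) + 7 * j ≤ k := by
            exact_mod_cast (by omega : (g \ Y).card + 7 * j ≤ k)
          linarith)
        (fun f hf _ => by
          obtain ⟨y, hy⟩ := hF f (hHF (hH' hf)) g hgS.1
          rw [Finset.mem_inter] at hy
          have hyY : y ∉ Y := fun hyY => Finset.disjoint_left.1 hgS.2 hy.2
            (hZS (hYZ f hf ▸ Finset.mem_inter.2 ⟨hy.1, hyY⟩))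
          have : 0 < (f ∩ (g \ Y)).card := Finset.card_pos.2
            ⟨y, Finset.mem_inter.2 ⟨hy.1, Finset.mem_sdiff.2 ⟨hy.2, hyY⟩⟩⟩
          simpa using (by exact_mod_cast this : (1 : ℝ) ≤ (f ∩ (g \ Y)).card))
      rw [Finset.mem_singleton] at hg'
      subst hg'
      exact ⟨x, Finset.disjoint_left.1 hgS.2 (Finset.mem_sdiff.1 hx).1,
        hZS.trans (Finset.subset_insert _ _), by simpa using hxle⟩)
    (fun S _ hS => hS ▸ degSet_le_pow hkpos hk hF hτ (hH'.trans hHF) S (by omega)) Z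
    Finset.Subset.rfl (by omega)
  have hdeg : degSet H' Z = H'.card := by
    rw [degSet, Finset.filter_true_of_mem]
    exact fun f hf => hYZ f hf ▸ Finset.inter_subset_left
  rw [hdeg] at hmain
  have hexp : ((k : ℝ) - 7 * j) ^ (L - Z.card) ≤ Real.exp (-6) ^ j * (k : ℝ) ^ (L - Z.card) := by
    refine (sub_pow_le_exp_mul_pow hk0 (by linarith) _).trans ?_
    gcongr
    rw [← Real.exp_nat_mul, Real.exp_le_exp]
    have hLZ : 7 / 8 * (k : ℝ) - 12 * j ≤ (L - Z.card : ℕ) := by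
      rw [Nat.cast_sub (by omega)]
      have h1 : (7 : ℝ) * k ≤ 8 * L := by exact_mod_cast hL
      have h2 : (Z.card : ℝ) ≤ 12 * j := by exact_mod_cast hZ
      linarith
    have : (j : ℝ) * 6 ≤ 7 * j * (L - Z.card : ℕ) / k := by
      rw [le_div_iff₀ hk0]
      have : (6 : ℝ) * k ≤ 7 * (L - Z.card : ℕ) := by linarith
      nlinarith
    linarith
  have hnum : ((3 : ℝ) / 2) ^ 12 * Real.exp (-6) ≤ 1 / 3 := by
    rw [Real.exp_neg, ← div_eq_mul_inv, div_le_iff₀ (Real.exp_pos _)]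
    have h1 : Real.exp 6 = Real.exp 1 ^ 6 := by rw [← Real.exp_nat_mul]; norm_num
    have h2 : (2.718 : ℝ) ^ 6 ≤ Real.exp 1 ^ 6 := by
      gcongr
      linarith [Real.exp_one_gt_d9]
    rw [h1]
    norm_num at h2 ⊢
    linarith
  have hpow : (k : ℝ) ^ (L - Z.card) * (k : ℝ) ^ (k - L) * (k : ℝ) ^ Z.card = (k : ℝ) ^ k := by
    rw [← pow_add, ← pow_add]
    congr 1
    omega
  have hH'le : (H'.card : ℝ) * (k : ℝ) ^ Z.card ≤ Real.exp (-6) ^ j * (k : ℝ) ^ k := by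
    calc (H'.card : ℝ) * (k : ℝ) ^ Z.card
        ≤ (Real.exp (-6) ^ j * (k : ℝ) ^ (L - Z.card)) * (k : ℝ) ^ (k - L) * (k : ℝ) ^ Z.card := by
          gcongr
          refine hmain.trans ?_
          gcongr
      _ = _ := by rw [← hpow]; ring
  have hle2 : (2 / 3) ^ (12 * j) * (H.card * (1 / 2) : ℝ) ≤ Real.exp (-6) ^ j * (k : ℝ) ^ k := by
    refine hle.trans (le_trans ?_ hH'le)
    refine mul_le_of_le_one_right (by positivity) ?_
    have : 0 ≤ 2 ^ (7 * j) * 1000 / (F.card : ℝ) * thinWeight F (7 * j) Y := by positivity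
    linarith
  calc (H.card : ℝ) = 2 * ((3 / 2) ^ (12 * j) * ((2 / 3) ^ (12 * j) * (H.card * (1 / 2) : ℝ))) := by
        rw [← mul_assoc ((3 / 2 : ℝ) ^ (12 * j)), ← mul_pow]
        norm_num
        ring
    _ ≤ 2 * ((3 / 2) ^ (12 * j) * (Real.exp (-6) ^ j * (k : ℝ) ^ k)) := by gcongr
    _ = 2 * (((3 / 2) ^ 12 * Real.exp (-6)) ^ j * (k : ℝ) ^ k) := by
        rw [pow_mul, mul_pow]
        ring
    _ ≤ _ := by gcongr

/-- If every vertex lies in at most a proportion `1 / (40 * j)` of the members of `F`, then the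
trivial bound `k ^ k` improves by a factor exponential in `j`. -/
theorem card_le_of_degVert_le (hk : ∀ f ∈ F, f.card = k)
    (hF : IntersectingFamily F) (hτ : ∀ S : Finset α, S.card < k → ∃ f ∈ F, Disjoint f S)
    (hη : ∀ x, (degVert F x : ℝ) ≤ η) (hη0 : 0 ≤ η)
    (hηj : η * (40 * j) ≤ F.card) (hj : 20 ≤ j) (hjk : 672 * j ≤ k) :
    (F.card : ℝ) ≤ 6 * ((1 / 3) ^ j * (k : ℝ) ^ k) := by
  have hkpos : 0 < k := by omega
  have hpos : 0 ≤ (1 / 3) ^ j * (k : ℝ) ^ k := by positivity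
  rcases Nat.eq_zero_or_pos F.card with h0 | hn
  · rw [h0]
    push_cast
    positivity
  classical
  let conc : Finset α → Prop := fun f => ∃ C ⊆ f, 8 * C.card ≤ 7 * k ∧
    1000 * ((F.filter fun g => Disjoint g C).card : ℝ) ≤ F.card
  have hsplit := cast_card_filter_add_card_filter_not F conc
  rcases le_total (F.card : ℝ) (2 * (F.filter conc).card) with hc | hc
  · choose! A hA using fun f (hf : f ∈ F.filter conc) => (Finset.mem_filter.1 hf).2
    have := card_le_of_concentrated hkpos hk hF hτ hn hη hηj (by omega) (F.filter conc)
      (Finset.filter_subset _ _) hc A (fun g hg => (hA g hg).1) (fun g hg => (hA g hg).2.1)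
      (fun g hg => (hA g hg).2.2)
    linarith
  · let N := F.filter fun f => ¬ conc f
    let dbl : Finset α → Prop := fun f =>
      (F.card : ℝ) ≤ 3 * ((F.filter fun g => (f ∩ g).card ≠ 1).card : ℕ)
    have hNF : N ⊆ F := Finset.filter_subset _ _
    have hN := cast_card_filter_add_card_filter_not N dbl
    have h1 := card_le_of_double_intersections hkpos hk hF hτ hn hη hηj (by omega)
      ((Finset.filter_subset dbl N).trans hNF) fun f hf => (Finset.mem_filter.1 hf).2
    have h2 := card_le_of_single_intersections hk hF hτ hn hη hη0 hηj hj hjk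
      (L := (7 * k + 7) / 8) (by omega) (by omega) (H := N.filter fun f => ¬ dbl f)
      ((Finset.filter_subset _ N).trans hNF)
      (fun f hf => by
        have h3 := not_le.1 (Finset.mem_filter.1 hf).2
        have h4 := cast_card_filter_add_card_filter_not F fun g => (f ∩ g).card = 1
        linarith)
      (fun f hf C hCf hC => by
        have h3 := (Finset.mem_filter.1 (Finset.mem_filter.1 hf).1).2
        by_contra hlt
        exact h3 ⟨C, hCf, by omega, (not_le.1 hlt).le⟩)
    have h5 : (N.card : ℝ) = ((F.filter fun f => ¬ conc f).card : ℝ) := rfl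
    linarith

end Cases

/-- small maximum degree forces a small family. -/
theorem small_max_degree_small_family :
    ∀ a : ℝ, 0 < a → ∃ k₀ : ℕ, ∀ k : ℕ, k₀ ≤ k →
      ∀ (α : Type) [DecidableEq α] (X : Finset α) (F : Finset (Finset α)),
        (∀ f ∈ F, f ⊆ X) → (∀ f ∈ F, f.card = k) → IntersectingFamily F →
        coverNum F = k →
        (∀ x ∈ X, (degVert F x : ℝ) ≤ (F.card : ℝ) / (40 * a * Real.log k)) →
        (F.card : ℝ) ≤
          max (2 * (k : ℝ) ^ ((2 * (k : ℝ)) / 3)) (Real.exp 1 * (k : ℝ) ^ ((k : ℝ) - a)) := by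
  intro a ha
  have hlog : Filter.Tendsto (fun k : ℕ => a * Real.log k) Filter.atTop Filter.atTop :=
    (Real.tendsto_log_atTop.comp tendsto_natCast_atTop_atTop).const_mul_atTop ha
  have hsmall : ∀ᶠ k : ℕ in Filter.atTop, 672 * (a * Real.log k) ≤ k := by
    have h := (Real.isLittleO_log_id_atTop.comp_tendsto tendsto_natCast_atTop_atTop).def
      (c := 1 / (672 * a)) (by positivity)
    filter_upwards [h, Filter.eventually_ge_atTop 1] with k hk hk1
    have hk1' : (1 : ℝ) ≤ k := by exact_mod_cast hk1
    simp only [Function.comp_apply, id, Real.norm_eq_abs, abs_of_nonneg (Real.log_nonneg hk1'),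
      abs_of_nonneg (zero_le_one.trans hk1')] at hk
    calc 672 * (a * Real.log k) = 672 * a * Real.log k := by ring
      _ ≤ 672 * a * (1 / (672 * a) * k) := by gcongr
      _ = k := by field_simp
  obtain ⟨k₀, hk₀⟩ := Filter.eventually_atTop.1
    ((hlog.eventually_ge_atTop 200).and (hsmall.and (Filter.eventually_ge_atTop 1)))
  refine ⟨k₀, fun k hkk α _ X F hFX hk hF hcov hdeg => le_max_of_le_right ?_⟩
  obtain ⟨hl, hlk, hk1⟩ := hk₀ k hkk
  set l := a * Real.log k with hldef
  have hk0 : (0 : ℝ) < k := by exact_mod_cast hk1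
  have hτ : ∀ S : Finset α, S.card < k → ∃ f ∈ F, Disjoint f S := by
    intro S hS
    by_contra! hcon
    refine Nat.notMem_of_lt_sInf (hS.trans_eq hcov.symm) ⟨S, rfl, fun f hf => ?_⟩
    exact Finset.not_disjoint_iff_nonempty_inter.1 (hcon f hf)
  have h40 : 40 * a * Real.log k = 40 * l := by rw [hldef]; ring
  rw [h40] at hdeg
  have hη0 : (0 : ℝ) ≤ F.card / (40 * l) := by positivity
  have hη : ∀ x, (degVert F x : ℝ) ≤ F.card / (40 * l) := by
    intro x
    by_cases hx : x ∈ X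
    · exact hdeg x hx
    · have : degVert F x = 0 :=
        Finset.card_eq_zero.2 (Finset.filter_eq_empty_iff.2 fun f hf hxf => hx (hFX f hf hxf))
      rw [this]
      exact_mod_cast hη0
  have hjl : (⌊l⌋₊ : ℝ) ≤ l := Nat.floor_le (by linarith)
  have hlj : l < ⌊l⌋₊ + 1 := Nat.lt_floor_add_one l
  have hmain := card_le_of_degVert_le (j := ⌊l⌋₊) hk hF hτ hη hη0
    (by
      calc (F.card : ℝ) / (40 * l) * (40 * ⌊l⌋₊) ≤ F.card / (40 * l) * (40 * l) := by gcongr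
        _ = F.card := by field_simp)
    (Nat.le_floor (by push_cast; linarith))
    (by
      have : (672 : ℝ) * ⌊l⌋₊ ≤ k := by linarith
      exact_mod_cast this)
  have hrpow : (k : ℝ) ^ ((k : ℝ) - a) = Real.exp (-l) * (k : ℝ) ^ k := by
    rw [Real.rpow_sub hk0, Real.rpow_natCast, Real.rpow_def_of_pos hk0, Real.exp_neg, hldef,
      mul_comm a]
    ring
  have hthird : (6 : ℝ) * (1 / 3) ^ ⌊l⌋₊ ≤ Real.exp 1 * Real.exp (-l) := by
    have h3 : (1 / 3 : ℝ) ≤ Real.exp (-(21 / 20)) := by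
      rw [Real.exp_neg, one_div]
      refine inv_anti₀ (Real.exp_pos _) ?_
      have h4 : Real.exp (21 / 20) ^ 20 ≤ 3 ^ 20 := by
        rw [← Real.exp_nat_mul]
        have h5 : Real.exp ((20 : ℕ) * (21 / 20)) = Real.exp 1 ^ 21 := by
          rw [← Real.exp_nat_mul]
          norm_num
        rw [h5]
        calc Real.exp 1 ^ 21 ≤ (2.7182818286 : ℝ) ^ 21 := by
              gcongr
              exact Real.exp_one_lt_d9.le
          _ ≤ _ := by norm_num
      exact le_of_pow_le_pow_left₀ (by norm_num) (by norm_num) h4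
    have h6 : (6 : ℝ) ≤ Real.exp 5 := by linarith [Real.add_one_le_exp (5 : ℝ)]
    calc (6 : ℝ) * (1 / 3) ^ ⌊l⌋₊ ≤ Real.exp 5 * Real.exp (-(21 / 20)) ^ ⌊l⌋₊ := by gcongr
      _ = Real.exp (5 + ⌊l⌋₊ * -(21 / 20)) := by rw [← Real.exp_nat_mul, Real.exp_add]
      _ ≤ Real.exp (1 + -l) := by
          rw [Real.exp_le_exp]
          linarith
      _ = _ := Real.exp_add _ _
  calc (F.card : ℝ) ≤ 6 * (1 / 3) ^ ⌊l⌋₊ * (k : ℝ) ^ k := by linarith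
    _ ≤ Real.exp 1 * Real.exp (-l) * (k : ℝ) ^ k := by gcongr
    _ = _ := by rw [hrpow]; ring
end

section
/- Every k-uniform intersecting family F on a finite set X with covering number τ(F) = k satisfies |F| ≤ k^k. -/
/-- A set smaller than the covering number misses some member of the family. -/
theorem exists_disjoint_of_card_lt_coverNum_s5 {α : Type} [DecidableEq α] {F : Finset (Finset α)}
    {S : Finset α} (hS : S.card < coverNum F) : ∃ g ∈ F, Disjoint g S := by
  by_contra! h
  refine hS.not_ge (Nat.sInf_le ⟨S, rfl, fun f hf => ?_⟩)
  exact Finset.not_disjoint_iff_nonempty_inter.mp (h f hf)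

/-- In an intersecting `k`-uniform family with covering number at least `k`, a set of size
`k - m` has degree at most `k ^ m`. -/
theorem degSet_le_pow_s5 {α : Type} [DecidableEq α] {k : ℕ} {F : Finset (Finset α)}
    (huni : ∀ f ∈ F, f.card = k) (hint : IntersectingFamily F) (hcov : k ≤ coverNum F)
    (m : ℕ) (S : Finset α) (hS : S.card + m = k) : degSet F S ≤ k ^ m := by
  induction m generalizing S with
  | zero =>
    rw [pow_zero, degSet, Finset.card_le_one]
    have eq_of_mem : ∀ f ∈ F.filter fun f => S ⊆ f, S = f := fun f hf => by
      rw [Finset.mem_filter] at hf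
      exact Finset.eq_of_subset_of_card_le hf.2 (by rw [huni f hf.1]; omega)
    intro f hf g hg
    rw [← eq_of_mem f hf, ← eq_of_mem g hg]
  | succ m ih =>
    obtain ⟨g, hg, hgS⟩ := exists_disjoint_of_card_lt_coverNum_s5 (F := F) (S := S) (by omega)
    have hsub : (F.filter fun f => S ⊆ f) ⊆
        g.biUnion fun x => F.filter fun f => insert x S ⊆ f := by
      intro f hf
      rw [Finset.mem_filter] at hf
      obtain ⟨x, hx⟩ := hint f hf.1 g hg
      rw [Finset.mem_inter] at hx
      simp only [Finset.mem_biUnion, Finset.mem_filter]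
      exact ⟨x, hx.2, hf.1, Finset.insert_subset hx.1 hf.2⟩
    calc degSet F S ≤ _ := Finset.card_le_card hsub
      _ ≤ g.card * k ^ m := Finset.card_biUnion_le_card_mul _ _ _ fun x hx => by
        refine ih (insert x S) ?_
        rw [Finset.card_insert_of_notMem (Finset.disjoint_left.mp hgS hx)]
        omega
      _ = k ^ (m + 1) := by rw [huni g hg, pow_succ']

/-- the Erdős–Lovász bound `|F| ≤ k^k`. -/
theorem erdos_lovasz_bound {α : Type} [DecidableEq α] (k : ℕ)
    (X : Finset α) (F : Finset (Finset α))
    (hX : ∀ f ∈ F, f ⊆ X) (huni : ∀ f ∈ F, f.card = k)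
    (hint : IntersectingFamily F) (hcov : coverNum F = k) :
    F.card ≤ k ^ k := by
  simpa [degSet] using degSet_le_pow_s5 huni hint hcov.ge k ∅ (by simp)
end
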